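/- For every fanning frame A there exists a smooth curve X : ℝ → Matrix (Fin n) (Fin n) ℝ with X(0) = I, X(t) invertible for every t ∈ ℝ, and X'(t) = −X(t)P_1(t) for all t; and for any such X the frame B(t) := A(t)X(t)⁻¹ is a normal fanning frame whose columns span the same subspace of ℝ^{kn} as the columns of A(t), for every t. In particular, every fanning curve of n-dimensional subspaces of ℝ^{kn} is spanned by a normal frame. -/

import Mathlib

open Matrix

noncomputable def mderiv {M N : ℕ} (A : ℝ → Matrix (Fin M) (Fin N) ℝ) :
    ℝ → Matrix (Fin M) (Fin N) ℝ :=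
  fun t => Matrix.of fun i j => deriv (fun s => A s i j) t

noncomputable def dmat {M N : ℕ} (i : ℕ) (A : ℝ → Matrix (Fin M) (Fin N) ℝ) :
    ℝ → Matrix (Fin M) (Fin N) ℝ :=
  mderiv^[i] A

def MatSmooth {M N : ℕ} (A : ℝ → Matrix (Fin M) (Fin N) ℝ) : Prop :=
  ∀ i j, ContDiff ℝ (⊤ : ℕ∞) fun t => A t i j

def juxt (k n : ℕ) (B : Fin k → Matrix (Fin (k * n)) (Fin n) ℝ) :
    Matrix (Fin (k * n)) (Fin (k * n)) ℝ :=
  Matrix.of fun r c => B (finProdFinEquiv.symm c).1 r (finProdFinEquiv.symm c).2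

noncomputable def frameMat (k n : ℕ) (A : ℝ → Matrix (Fin (k * n)) (Fin n) ℝ) (t : ℝ) :
    Matrix (Fin (k * n)) (Fin (k * n)) ℝ :=
  juxt k n fun i => dmat (i : ℕ) A t

def IsFanning (k n : ℕ) (A : ℝ → Matrix (Fin (k * n)) (Fin n) ℝ) : Prop :=
  MatSmooth A ∧ ∀ t, IsUnit (frameMat k n A t)

def IsCoeffs (k n : ℕ) (A : ℝ → Matrix (Fin (k * n)) (Fin n) ℝ)
    (P : ℕ → ℝ → Matrix (Fin n) (Fin n) ℝ) : Prop :=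
  (∀ i ∈ Finset.Icc 1 k, MatSmooth (P i)) ∧
  ∀ t, dmat k A t + ∑ i ∈ Finset.Icc 1 k, (k.choose i : ℝ) • (dmat (k - i) A t * P i t) = 0

open scoped ContDiff

theorem intervalIntegral.norm_integral_zero_le_of_norm_le_abs_pow {E : Type*}
    [NormedAddCommGroup E] [NormedSpace ℝ E] {f : ℝ → E} {c : ℝ} {m : ℕ} {t : ℝ}
    (h : ∀ s, |s| ≤ |t| → ‖f s‖ ≤ c * |s| ^ m) :
    ‖∫ s in (0 : ℝ)..t, f s‖ ≤ c * (|t| ^ (m + 1) / (m + 1)) := by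
  rw [intervalIntegral.norm_intervalIntegral_eq]
  have hint := integral_pow_abs_sub_uIoc (a := 0) (b := t) (n := m)
  simp only [sub_zero] at hint
  rw [← hint, ← MeasureTheory.integral_const_mul]
  refine MeasureTheory.norm_integral_le_of_norm_le ?_ ?_
  · exact ((by fun_prop : Continuous fun s : ℝ => c * |s| ^ m).intervalIntegrable 0 t).def'
  · filter_upwards [MeasureTheory.ae_restrict_mem measurableSet_uIoc] with s hs
    refine h s ?_
    have hs' := Set.uIoc_subset_uIcc hs
    simpa using Set.abs_sub_left_of_mem_uIcc hs'

/-- The terms of the Dyson series solving `X' = X * C`, `X 0 = 1`. -/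
noncomputable def dysonTerm {E : Type*} [NormedRing E] [NormedAlgebra ℝ E] (C : ℝ → E) :
    ℕ → ℝ → E
  | 0 => fun _ => 1
  | m + 1 => fun t => ∫ s in (0 : ℝ)..t, dysonTerm C m s * C s

section Dyson

variable {E : Type*} [NormedRing E] [NormedAlgebra ℝ E] {C : ℝ → E}

theorem continuous_dysonTerm (hC : Continuous C) (m : ℕ) : Continuous (dysonTerm C m) := by
  induction m with
  | zero => exact continuous_const
  | succ m ih =>
    exact intervalIntegral.continuous_primitive
      (fun a b => (ih.mul hC).intervalIntegrable a b) 0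

theorem hasDerivAt_dysonTerm_succ [CompleteSpace E] (hC : Continuous C) (m : ℕ) (t : ℝ) :
    HasDerivAt (dysonTerm C (m + 1)) (dysonTerm C m t * C t) t :=
  ((continuous_dysonTerm hC m).mul hC).integral_hasStrictDerivAt 0 t |>.hasDerivAt

theorem norm_dysonTerm_le {K T : ℝ} (hK : ∀ t, |t| ≤ T → ‖C t‖ ≤ K) (m : ℕ) {t : ℝ}
    (ht : |t| ≤ T) : ‖dysonTerm C m t‖ ≤ ‖(1 : E)‖ * K ^ m / m.factorial * |t| ^ m := by
  induction m generalizing t with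
  | zero => simp [dysonTerm]
  | succ m ih =>
    have hK0 : 0 ≤ K := (norm_nonneg _).trans (hK t ht)
    refine (intervalIntegral.norm_integral_zero_le_of_norm_le_abs_pow (m := m)
      (c := ‖(1 : E)‖ * K ^ m / m.factorial * K) fun s hs => ?_).trans_eq ?_
    · refine (norm_mul_le _ _).trans ?_
      calc ‖dysonTerm C m s‖ * ‖C s‖
          ≤ (‖(1 : E)‖ * K ^ m / m.factorial * |s| ^ m) * K :=
            mul_le_mul (ih (hs.trans ht)) (hK s (hs.trans ht)) (norm_nonneg _) (by positivity)
        _ = _ := by ring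
    · rw [Nat.factorial_succ]
      push_cast
      field_simp
      ring

/-- Global existence for the linear equation `X' = X * C` in a Banach algebra. -/
theorem exists_hasDerivAt_eq_mul [CompleteSpace E] (hC : Continuous C) :
    ∃ X : ℝ → E, X 0 = 1 ∧ ∀ t, HasDerivAt X (X t * C t) t := by
  have hzero : ∀ m, dysonTerm C (m + 1) 0 = 0 := fun m => by simp [dysonTerm]
  refine ⟨fun t => ∑' m, dysonTerm C m t, ?_, fun t => ?_⟩
  · beta_reduce
    rw [tsum_eq_single 0]
    · simp [dysonTerm]
    · rintro (_ | m) hm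
      · exact absurd rfl hm
      · exact hzero m
  · obtain ⟨K, hK⟩ := (isCompact_Icc (a := -(|t| + 1)) (b := |t| + 1)).exists_bound_of_continuousOn
      hC.continuousOn
    replace hK : ∀ s, |s| ≤ |t| + 1 → ‖C s‖ ≤ K := fun s hs => hK s (abs_le.mp hs)
    have hK0 : 0 ≤ K := (norm_nonneg _).trans (hK t (by linarith))
    set T := |t| + 1 with hT
    have hT0 : 0 ≤ T := by positivity
    have hbound : ∀ m s, |s| ≤ T →
        ‖dysonTerm C m s‖ ≤ ‖(1 : E)‖ * ((K * T) ^ m / m.factorial) := fun m s hs => by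
      refine (norm_dysonTerm_le hK m hs).trans ?_
      calc ‖(1 : E)‖ * K ^ m / m.factorial * |s| ^ m
          ≤ ‖(1 : E)‖ * K ^ m / m.factorial * T ^ m := by gcongr
        _ = _ := by rw [mul_pow]; ring
    have hsum : Summable fun m : ℕ => ‖(1 : E)‖ * ((K * T) ^ m / m.factorial) :=
      (Real.summable_pow_div_factorial _).mul_left _
    have hsummable : ∀ s, |s| ≤ T → Summable fun m => dysonTerm C m s :=
      fun s hs => .of_norm_bounded hsum fun m => hbound m s hs
    have hderiv : HasDerivAt (fun s => ∑' m, dysonTerm C (m + 1) s)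
        (∑' m, dysonTerm C m t * C t) t := by
      refine hasDerivAt_tsum_of_isPreconnected (hsum.mul_right K) isOpen_Ioo
        (isPreconnected_Ioo (a := -T) (b := T))
        (fun m s _ => hasDerivAt_dysonTerm_succ hC m s) (fun m s hs => ?_)
        (y₀ := 0) ⟨by linarith [abs_nonneg t], by linarith [abs_nonneg t]⟩ ?_
        (abs_lt.mp (by linarith))
      · have hs' : |s| ≤ T := (abs_lt.mpr hs).le
        exact (norm_mul_le _ _).trans
          (mul_le_mul (hbound m s hs') (hK s hs') (norm_nonneg _) (by positivity))
      · simp only [hzero]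
        exact summable_zero
    rw [(hsummable t (by linarith)).tsum_mul_right] at hderiv
    refine (hderiv.const_add 1).congr_of_eventuallyEq ?_
    filter_upwards [isOpen_Ioo.mem_nhds (show t ∈ Set.Ioo (-T) T from
      abs_lt.mp (by linarith))] with s hs
    rw [(hsummable s (abs_lt.mpr hs).le).tsum_eq_zero_add]
    rfl

end Dyson

section MatrixCurves

variable {L M N : ℕ}

theorem dmat_apply (m : ℕ) (A : ℝ → Matrix (Fin M) (Fin N) ℝ) (t : ℝ) (i : Fin M) (j : Fin N) :
    dmat m A t i j = iteratedDeriv m (fun s => A s i j) t := by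
  induction m generalizing t with
  | zero => simp [dmat]
  | succ m ih =>
    rw [dmat, Function.iterate_succ_apply', iteratedDeriv_succ]
    exact congrArg (deriv · t) (funext ih)

theorem dmat_zero (A : ℝ → Matrix (Fin M) (Fin N) ℝ) : dmat 0 A = A := rfl

theorem dmat_one (A : ℝ → Matrix (Fin M) (Fin N) ℝ) : dmat 1 A = mderiv A := rfl

theorem MatSmooth.dmat {A : ℝ → Matrix (Fin M) (Fin N) ℝ} (hA : MatSmooth A) (m : ℕ) :
    MatSmooth (dmat m A) := fun i j => by
  simp only [dmat_apply]
  rw [iteratedDeriv_eq_iterate]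
  exact ContDiff.iterate_deriv m (hA i j)

theorem MatSmooth.mul {A : ℝ → Matrix (Fin L) (Fin M) ℝ} {B : ℝ → Matrix (Fin M) (Fin N) ℝ}
    (hA : MatSmooth A) (hB : MatSmooth B) : MatSmooth fun t => A t * B t := fun i j => by
  simp only [Matrix.mul_apply]
  exact ContDiff.sum fun l _ => (hA i l).mul (hB l j)

theorem MatSmooth.neg {A : ℝ → Matrix (Fin M) (Fin N) ℝ} (hA : MatSmooth A) :
    MatSmooth fun t => -A t := fun i j => (hA i j).neg

theorem MatSmooth.sum {ι : Type*} {s : Finset ι} {A : ι → ℝ → Matrix (Fin M) (Fin N) ℝ}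
    (hA : ∀ i ∈ s, MatSmooth (A i)) : MatSmooth fun t => ∑ i ∈ s, A i t := fun a b => by
  simp only [Matrix.sum_apply]
  exact ContDiff.sum fun i hi => hA i hi a b

theorem MatSmooth.const_smul {A : ℝ → Matrix (Fin M) (Fin N) ℝ} (hA : MatSmooth A)
    (c : ℝ) : MatSmooth fun t => c • A t := fun i j => (hA i j).const_smul c

theorem matSmooth_const (C : Matrix (Fin M) (Fin N) ℝ) : MatSmooth fun _ => C :=
  fun _ _ => contDiff_const

theorem MatSmooth.transpose {A : ℝ → Matrix (Fin M) (Fin N) ℝ} (hA : MatSmooth A) :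
    MatSmooth fun t => (A t)ᵀ := fun i j => hA j i

theorem MatSmooth.det {A : ℝ → Matrix (Fin N) (Fin N) ℝ} (hA : MatSmooth A) :
    ContDiff ℝ ∞ fun t => (A t).det := by
  simp only [Matrix.det_apply]
  exact ContDiff.sum fun σ _ => (contDiff_prod fun i _ => hA (σ i) i).const_smul _

theorem MatSmooth.inv {A : ℝ → Matrix (Fin N) (Fin N) ℝ} (hA : MatSmooth A)
    (hu : ∀ t, IsUnit (A t)) : MatSmooth fun t => (A t)⁻¹ := fun i j => by
  have hdet : ∀ t, (A t).det ≠ 0 := fun t => ((Matrix.isUnit_iff_isUnit_det _).mp (hu t)).ne_zero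
  simp only [Matrix.inv_def, Ring.inverse_eq_inv', Matrix.smul_apply, smul_eq_mul,
    Matrix.adjugate_apply]
  refine (hA.det.inv hdet).mul (MatSmooth.det fun a b => ?_)
  by_cases h : a = j
  · subst h
    simpa using contDiff_const
  · simpa [Matrix.updateRow_ne h] using hA a b

/-- The Leibniz rule for matrix products. -/
theorem dmat_mul {A : ℝ → Matrix (Fin L) (Fin M) ℝ} {B : ℝ → Matrix (Fin M) (Fin N) ℝ}
    (hA : MatSmooth A) (hB : MatSmooth B) (m : ℕ) (t : ℝ) :
    dmat m (fun s => A s * B s) t =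
      ∑ l ∈ Finset.range (m + 1), (m.choose l : ℝ) • (dmat (m - l) A t * dmat l B t) := by
  have hle : (m : ℕ∞ω) ≤ ∞ := by exact_mod_cast le_top
  ext i j
  simp only [Matrix.sum_apply, Matrix.smul_apply, Matrix.mul_apply, dmat_apply, smul_eq_mul,
    Finset.mul_sum]
  rw [iteratedDeriv_fun_sum fun l _ =>
    (((hA i l).mul (hB l j)).of_le hle).contDiffAt, Finset.sum_comm]
  refine Finset.sum_congr rfl fun l _ => ?_
  have h := iteratedDeriv_mul (((hB l j).of_le hle).contDiffAt (x := t))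
    (((hA i l).of_le hle).contDiffAt (x := t))
  rw [mul_comm] at h
  refine Eq.trans h (Finset.sum_congr rfl fun r _ => by ring)

theorem mderiv_eq_of_hasDerivAt {A : ℝ → Matrix (Fin M) (Fin N) ℝ} {D : Matrix (Fin M) (Fin N) ℝ}
    {t : ℝ} (h : ∀ i j, HasDerivAt (fun s => A s i j) (D i j) t) : mderiv A t = D := by
  ext i j
  exact (h i j).deriv

theorem MatSmooth.of_hasDerivAt_mul {X C : ℝ → Matrix (Fin N) (Fin N) ℝ} (hC : MatSmooth C)
    (hX : ∀ t i j, HasDerivAt (fun s => X s i j) ((X t * C t) i j) t) : MatSmooth X := by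
  suffices h : ∀ m : ℕ, ∀ i j, ContDiff ℝ m fun t => X t i j from
    fun i j => contDiff_infty.mpr fun m => h m i j
  intro m
  induction m with
  | zero =>
    intro i j
    exact contDiff_zero.mpr (continuous_iff_continuousAt.mpr fun t => (hX t i j).continuousAt)
  | succ m ih =>
    intro i j
    push_cast
    refine contDiff_succ_iff_deriv.mpr ⟨fun t => (hX t i j).differentiableAt, by simp, ?_⟩
    rw [funext fun t => (hX t i j).deriv]
    simp only [Matrix.mul_apply]
    exact ContDiff.sum fun l _ => (ih i l).mul ((hC l j).of_le (by exact_mod_cast le_top))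

section

attribute [local instance] Matrix.linftyOpNormedRing Matrix.linftyOpNormedAlgebra

theorem exists_matrix_hasDerivAt_eq_mul {C : ℝ → Matrix (Fin N) (Fin N) ℝ} (hC : MatSmooth C) :
    ∃ X : ℝ → Matrix (Fin N) (Fin N) ℝ, X 0 = 1 ∧
      ∀ t i j, HasDerivAt (fun s => X s i j) ((X t * C t) i j) t := by
  have hcont : Continuous C := continuous_matrix fun i j => (hC i j).continuous
  obtain ⟨X, hX0, hX⟩ := exists_hasDerivAt_eq_mul hcont
  refine ⟨X, hX0, fun t i j => ?_⟩
  exact (LinearMap.toContinuousLinearMap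
    (Matrix.entryLinearMap ℝ ℝ i j)).hasFDerivAt.comp_hasDerivAt t (hX t)

end

/-- Global existence of a smooth invertible solution of `X' = X * C`, `X 0 = 1`. -/
theorem exists_matSmooth_isUnit_mderiv_eq_mul {C : ℝ → Matrix (Fin N) (Fin N) ℝ}
    (hC : MatSmooth C) :
    ∃ X : ℝ → Matrix (Fin N) (Fin N) ℝ, MatSmooth X ∧ X 0 = 1 ∧ (∀ t, IsUnit (X t)) ∧
      ∀ t, mderiv X t = X t * C t := by
  obtain ⟨X, hX0, hX⟩ := exists_matrix_hasDerivAt_eq_mul hC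
  obtain ⟨Y, hY0, hY⟩ := exists_matrix_hasDerivAt_eq_mul hC.transpose.neg
  refine ⟨X, .of_hasDerivAt_mul hC hX, hX0, fun t => ?_, fun t => mderiv_eq_of_hasDerivAt (hX t)⟩
  have hderiv : ∀ i j s, HasDerivAt (fun r => (X r * (Y r)ᵀ) i j) 0 s := fun i j s => by
    simp only [Matrix.mul_apply]
    have hsum := HasDerivAt.fun_sum (u := Finset.univ) fun l _ => (hX s i l).mul (hY s j l)
    refine hsum.congr_deriv ?_
    have hcancel : (X s * C s * (Y s)ᵀ + X s * (Y s * -(C s)ᵀ)ᵀ) i j = 0 := by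
      simp [Matrix.transpose_mul, Matrix.mul_assoc]
    rw [Matrix.add_apply, Matrix.mul_apply, Matrix.mul_apply, ← Finset.sum_add_distrib] at hcancel
    exact hcancel
  have hXY : X t * (Y t)ᵀ = 1 := by
    ext i j
    have h := is_const_of_deriv_eq_zero (fun s => (hderiv i j s).differentiableAt)
      (fun s => (hderiv i j s).deriv) t 0
    simpa [hX0, hY0] using h
  exact IsUnit.of_mul_eq_one _ hXY

/-- Applying the operator `∑ C(k,i) D^{k-i}(·) Pᵢ` to a product `B X` gives the operator of the
same shape, with coefficients `∑ C(j,i) X^{(j-i)} Pᵢ`, applied to `B`. -/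
theorem sum_choose_smul_dmat_mul {B : ℝ → Matrix (Fin M) (Fin N) ℝ}
    {X : ℝ → Matrix (Fin N) (Fin N) ℝ} (hB : MatSmooth B) (hX : MatSmooth X)
    (P : ℕ → ℝ → Matrix (Fin N) (Fin N) ℝ) (k : ℕ) (t : ℝ) :
    ∑ i ∈ Finset.range (k + 1), (k.choose i : ℝ) • (dmat (k - i) (fun s => B s * X s) t * P i t) =
      ∑ j ∈ Finset.range (k + 1), (k.choose j : ℝ) • (dmat (k - j) B t *
        ∑ i ∈ Finset.range (j + 1), (j.choose i : ℝ) • (dmat (j - i) X t * P i t)) := by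
  simp only [dmat_mul hB hX, Matrix.sum_mul, Matrix.mul_sum, Finset.smul_sum]
  rw [Finset.sum_sigma', Finset.sum_sigma']
  refine Finset.sum_bij' (fun p _ => ⟨p.1 + p.2, p.1⟩) (fun p _ => ⟨p.2, p.1 - p.2⟩) ?_ ?_ ?_ ?_ ?_
  · rintro ⟨i, l⟩ h
    simp only [Finset.mem_sigma, Finset.mem_range] at h ⊢
    omega
  · rintro ⟨j, i⟩ h
    simp only [Finset.mem_sigma, Finset.mem_range] at h ⊢
    omega
  · rintro ⟨i, l⟩ h
    simp
  · rintro ⟨j, i⟩ h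
    simp only [Finset.mem_sigma, Finset.mem_range] at h
    simp only [Sigma.mk.injEq, heq_eq_eq, and_true]
    omega
  · rintro ⟨i, l⟩ h
    have hchoose : (k.choose (i + l) : ℝ) * (i + l).choose i = k.choose i * (k - i).choose l := by
      have := Nat.choose_mul (n := k) (k := i + l) (s := i) (by omega)
      rw [Nat.add_sub_cancel_left] at this
      exact_mod_cast this
    simp only [Matrix.smul_mul, Matrix.mul_smul, smul_smul, hchoose, Matrix.mul_assoc,
      Nat.add_sub_cancel_left, Nat.sub_add_eq]

end MatrixCurves

/-- The frame matrix of `B X` factors through that of `B`. -/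
theorem exists_frameMat_mul_eq {k n : ℕ} {B : ℝ → Matrix (Fin (k * n)) (Fin n) ℝ}
    {X : ℝ → Matrix (Fin n) (Fin n) ℝ} (hB : MatSmooth B) (hX : MatSmooth X) (t : ℝ) :
    ∃ T, frameMat k n (fun s => B s * X s) t = frameMat k n B t * T := by
  refine ⟨Matrix.of fun r c => (((finProdFinEquiv.symm c).1 : ℕ).choose
    (finProdFinEquiv.symm r).1 : ℝ) *
      dmat ((finProdFinEquiv.symm c).1 - (finProdFinEquiv.symm r).1) X t
        (finProdFinEquiv.symm r).2 (finProdFinEquiv.symm c).2, ?_⟩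
  ext r c
  rw [Matrix.mul_apply, ← finProdFinEquiv.sum_comp, Fintype.sum_prod_type]
  obtain ⟨⟨i, a⟩, rfl⟩ := finProdFinEquiv.surjective c
  simp only [frameMat, juxt, Matrix.of_apply, Equiv.symm_apply_apply, dmat_mul hB hX,
    Matrix.sum_apply, Matrix.smul_apply, Matrix.mul_apply, smul_eq_mul]
  have hrange : ∑ j : Fin k, ∑ b, dmat (j : ℕ) B t r b *
      (((i : ℕ).choose j : ℝ) * dmat ((i : ℕ) - j) X t b a) =
      ∑ j ∈ Finset.range k, ∑ b, dmat j B t r b *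
        (((i : ℕ).choose j : ℝ) * dmat ((i : ℕ) - j) X t b a) :=
    Fin.sum_univ_eq_sum_range (fun j => ∑ b, dmat j B t r b *
      (((i : ℕ).choose j : ℝ) * dmat ((i : ℕ) - j) X t b a)) k
  rw [hrange, ← Finset.sum_subset (Finset.range_subset_range.mpr (Nat.succ_le_of_lt i.2)),
    ← Finset.sum_range_reflect]
  · refine Finset.sum_congr rfl fun j hj => ?_
    have hj' : j ≤ (i : ℕ) := Nat.lt_succ_iff.mp (Finset.mem_range.mp hj)
    rw [show (i : ℕ) + 1 - 1 - j = i - j by omega, Nat.choose_symm hj', Nat.sub_sub_self hj',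
      Finset.mul_sum]
    exact Finset.sum_congr rfl fun b _ => by ring
  · intro j _ hj
    have hj' : (i : ℕ) < j := by simpa using hj
    simp [Nat.choose_eq_zero_of_lt hj']

theorem IsFanning.mul_inv {k n : ℕ} {A : ℝ → Matrix (Fin (k * n)) (Fin n) ℝ}
    (hA : IsFanning k n A) {X : ℝ → Matrix (Fin n) (Fin n) ℝ} (hX : MatSmooth X)
    (hu : ∀ t, IsUnit (X t)) : IsFanning k n fun t => A t * (X t)⁻¹ := by
  have hB : MatSmooth fun t => A t * (X t)⁻¹ := hA.1.mul (hX.inv hu)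
  refine ⟨hB, fun t => ?_⟩
  obtain ⟨T, hT⟩ := exists_frameMat_mul_eq hB hX t
  have hcancel : (fun s => A s * (X s)⁻¹ * X s) = A := funext fun s =>
    Matrix.nonsing_inv_mul_cancel_right _ _ ((Matrix.isUnit_iff_isUnit_det _).mp (hu s))
  have hunit := hA.2 t
  rw [← hcancel, hT, Matrix.isUnit_iff_isUnit_det, Matrix.det_mul] at hunit
  exact (Matrix.isUnit_iff_isUnit_det _).mpr (isUnit_of_mul_isUnit_left hunit)

theorem sum_range_succ_update_zero {k n : ℕ} (A : ℝ → Matrix (Fin (k * n)) (Fin n) ℝ)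
    (P : ℕ → ℝ → Matrix (Fin n) (Fin n) ℝ) (U : ℝ → Matrix (Fin n) (Fin n) ℝ) (t : ℝ) :
    ∑ i ∈ Finset.range (k + 1),
        (k.choose i : ℝ) • (dmat (k - i) A t * Function.update P 0 U i t) =
      dmat k A t * U t +
        ∑ i ∈ Finset.Icc 1 k, (k.choose i : ℝ) • (dmat (k - i) A t * P i t) := by
  have hinsert : Finset.range (k + 1) = insert 0 (Finset.Icc 1 k) := by
    ext i
    simp only [Finset.mem_range, Finset.mem_insert, Finset.mem_Icc]
    omega
  rw [hinsert, Finset.sum_insert (by simp)]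
  congr 1
  · simp
  · refine Finset.sum_congr rfl fun i hi => ?_
    rw [Function.update_of_ne (by have := (Finset.mem_Icc.mp hi).1; omega)]

/-- The coefficients of the frame `A X⁻¹` in terms of those of `A`. -/
noncomputable def gaugeCoeff {n : ℕ} (P : ℕ → ℝ → Matrix (Fin n) (Fin n) ℝ)
    (X : ℝ → Matrix (Fin n) (Fin n) ℝ) (j : ℕ) (t : ℝ) : Matrix (Fin n) (Fin n) ℝ :=
  (∑ i ∈ Finset.range (j + 1),
    (j.choose i : ℝ) • (dmat (j - i) X t * Function.update P 0 (fun _ => 1) i t)) * (X t)⁻¹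

theorem gaugeCoeff_zero {n : ℕ} (P : ℕ → ℝ → Matrix (Fin n) (Fin n) ℝ)
    {X : ℝ → Matrix (Fin n) (Fin n) ℝ} (hu : ∀ t, IsUnit (X t)) (t : ℝ) :
    gaugeCoeff P X 0 t = 1 := by
  simp [gaugeCoeff, dmat_zero,
    Matrix.mul_nonsing_inv _ ((Matrix.isUnit_iff_isUnit_det _).mp (hu t))]

theorem gaugeCoeff_one {n : ℕ} (P : ℕ → ℝ → Matrix (Fin n) (Fin n) ℝ)
    (X : ℝ → Matrix (Fin n) (Fin n) ℝ) (t : ℝ) :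
    gaugeCoeff P X 1 t = (mderiv X t + X t * P 1 t) * (X t)⁻¹ := by
  simp [gaugeCoeff, Finset.sum_range_succ, dmat_zero, dmat_one]

theorem IsCoeffs.gauge {k n : ℕ} {A : ℝ → Matrix (Fin (k * n)) (Fin n) ℝ} (hA : MatSmooth A)
    {P : ℕ → ℝ → Matrix (Fin n) (Fin n) ℝ} (hP : IsCoeffs k n A P)
    {X : ℝ → Matrix (Fin n) (Fin n) ℝ} (hX : MatSmooth X) (hu : ∀ t, IsUnit (X t)) :
    IsCoeffs k n (fun t => A t * (X t)⁻¹) (gaugeCoeff P X) := by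
  refine ⟨fun j hj => ?_, fun t => ?_⟩
  · refine MatSmooth.mul (MatSmooth.sum fun i hi => ((hX.dmat _).mul ?_).const_smul _) (hX.inv hu)
    rcases Nat.eq_zero_or_pos i with rfl | hpos
    · simpa using matSmooth_const 1
    · rw [Function.update_of_ne hpos.ne']
      refine hP.1 i (Finset.mem_Icc.mpr ⟨hpos, ?_⟩)
      have := Finset.mem_range.mp hi
      have := (Finset.mem_Icc.mp hj).2
      omega
  · have hcancel : (fun s => A s * (X s)⁻¹ * X s) = A := funext fun s =>
      Matrix.nonsing_inv_mul_cancel_right _ _ ((Matrix.isUnit_iff_isUnit_det _).mp (hu s))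
    have hzero := sum_range_succ_update_zero A P (fun _ => 1) t
    rw [Matrix.mul_one, hP.2 t] at hzero
    have hprod := sum_choose_smul_dmat_mul (hA.mul (hX.inv hu)) hX
      (Function.update P 0 fun _ => 1) k t
    rw [hcancel, hzero] at hprod
    have hmul := congrArg (· * (X t)⁻¹) hprod
    simp only [Matrix.zero_mul, Matrix.sum_mul, Matrix.smul_mul, Matrix.mul_assoc] at hmul
    have hsplit := sum_range_succ_update_zero (fun t => A t * (X t)⁻¹) (gaugeCoeff P X)
      (gaugeCoeff P X 0) t
    rw [Function.update_eq_self, gaugeCoeff_zero P hu, Matrix.mul_one] at hsplit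
    rw [← hsplit, hmul]
    simp only [gaugeCoeff, Matrix.sum_mul, Matrix.smul_mul, Matrix.mul_assoc]

theorem range_mulVecLin_mul_inv {M N : ℕ} (A : Matrix (Fin M) (Fin N) ℝ)
    {X : Matrix (Fin N) (Fin N) ℝ} (hX : IsUnit X) :
    LinearMap.range (A * X⁻¹).mulVecLin = LinearMap.range A.mulVecLin := by
  rw [Matrix.mulVecLin_mul]
  refine LinearMap.range_comp_of_range_eq_top _ (LinearMap.range_eq_top.mpr fun v =>
    ⟨X *ᵥ v, ?_⟩)
  simp [Matrix.nonsing_inv_mul _ ((Matrix.isUnit_iff_isUnit_det _).mp hX)]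

/-- Every fanning frame admits a smooth invertible solution `X` of
`X' = -X P₁`, `X 0 = 1`; and for any such `X`, `B t = A t * (X t)⁻¹` is a normal fanning
frame spanning the same curve of subspaces as `A`. -/
theorem stmt_0 (k n : ℕ) (hk : 2 ≤ k) (hn : 1 ≤ n)
    (A : ℝ → Matrix (Fin (k * n)) (Fin n) ℝ) (hA : IsFanning k n A)
    (P : ℕ → ℝ → Matrix (Fin n) (Fin n) ℝ) (hP : IsCoeffs k n A P) :
    (∃ X : ℝ → Matrix (Fin n) (Fin n) ℝ, MatSmooth X ∧ X 0 = 1 ∧ (∀ t, IsUnit (X t)) ∧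
        ∀ t, mderiv X t = -(X t * P 1 t)) ∧
    ∀ X : ℝ → Matrix (Fin n) (Fin n) ℝ, MatSmooth X → X 0 = 1 → (∀ t, IsUnit (X t)) →
      (∀ t, mderiv X t = -(X t * P 1 t)) →
      IsFanning k n (fun t => A t * (X t)⁻¹) ∧
      (∃ Q : ℕ → ℝ → Matrix (Fin n) (Fin n) ℝ,
          IsCoeffs k n (fun t => A t * (X t)⁻¹) Q ∧ ∀ t, Q 1 t = 0) ∧
      ∀ t, LinearMap.range (A t * (X t)⁻¹).mulVecLin = LinearMap.range (A t).mulVecLin := by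
  refine ⟨?_, fun X hX _ hu hderiv => ⟨hA.mul_inv hX hu,
    ⟨gaugeCoeff P X, hP.gauge hA.1 hX hu, fun t => ?_⟩,
    fun t => range_mulVecLin_mul_inv _ (hu t)⟩⟩
  · have hP₁ : MatSmooth (P 1) := hP.1 1 (Finset.mem_Icc.mpr ⟨le_rfl, by omega⟩)
    simpa only [Matrix.mul_neg] using exists_matSmooth_isUnit_mderiv_eq_mul hP₁.neg
  · rw [gaugeCoeff_one, hderiv, neg_add_cancel, Matrix.zero_mul]
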